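/- Every clean 0-intersecting (3,3)-configuration has at least one good crossing. Precisely: let C₀, C₁, C₂ be three pairwise disjoint simple closed curves in the plane forming a nonseparating collection, and let A₀, A₁, A₂ be arcs, each with initial point on C₀, final point on C₂, meeting C₁ in exactly one point tangentially, such that each initial subarc (from C₀ to the tangential point) avoids C₂ and each final subarc (from the tangential point to C₂) avoids C₀. Then some pair of distinct arcs Aᵢ, Aⱼ has a crossing that is either between an initial subarc of one and a final subarc of the other, or between two initial subarcs. -/

import Mathlib

open Set

/-- A simple closed curve in the plane: the injective continuous image of a circle. -/
def IsSimpleClosedCurve (C : Set (ℝ × ℝ)) : Prop :=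
  ∃ f : C(AddCircle (1 : ℝ), ℝ × ℝ), Function.Injective f ∧ Set.range f = C

/-- A nowhere vanishing continuous complex function on the plane has a continuous logarithm. -/
theorem exists_log_plane (f : ℝ × ℝ → ℂ) (hf : Continuous f) (h0 : ∀ x, f x ≠ 0) :
    ∃ L : ℝ × ℝ → ℂ, Continuous L ∧ ∀ x, Complex.exp (L x) = f x := by
  obtain ⟨F, ⟨-, hF⟩, -⟩ := Complex.isCoveringMap_exp.existsUnique_continuousMap_lifts
    (A := ℝ × ℝ) ⟨fun x => ⟨f x, h0 x⟩, by fun_prop⟩ (0, 0) (Complex.log (f (0, 0)))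
    (by ext; simp [Complex.exp_log (h0 _)])
  refine ⟨F, F.continuous, fun x => ?_⟩
  have := congrFun hF x
  simpa using congrArg Subtype.val this

/-- Two continuous logarithms of the same function on a connected space differ by a constant. -/
theorem log_diff {X : Type*} [TopologicalSpace X] [PreconnectedSpace X] (f g : X → ℂ)
    (hf : Continuous f) (hg : Continuous g)
    (h : ∀ x, Complex.exp (f x) = Complex.exp (g x)) (x y : X) : f x - f y = g x - g y := by
  have hk := Complex.isCoveringMap_exp.eq_of_comp_eq (g₁ := f) (g₂ := fun z => g z + (f y - g y))
    hf (by fun_prop) (by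
      funext z
      ext
      simp only [Function.comp]
      rw [Complex.exp_add, Complex.exp_sub, h y, div_self (Complex.exp_ne_zero _), mul_one, h z])
    y (by ring)
  have h2 : f x = g x + (f y - g y) := congrFun hk x
  rw [h2]; ring

/-- The increment over `[0,1]` of a continuous logarithm of `g`. -/
noncomputable def logInc (g : ℝ → ℂ) : ℂ :=
  open Classical in
  if h : ∃ L : ℝ → ℂ, Continuous L ∧ ∀ x, Complex.exp (L x) = g x then
    h.choose 1 - h.choose 0 else 0

theorem logInc_eq (g L : ℝ → ℂ) (hL : Continuous L) (h : ∀ x, Complex.exp (L x) = g x) :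
    logInc g = L 1 - L 0 := by
  have hex : ∃ L : ℝ → ℂ, Continuous L ∧ ∀ x, Complex.exp (L x) = g x := ⟨L, hL, h⟩
  unfold logInc
  rw [dif_pos hex]
  exact log_diff _ _ hex.choose_spec.1 hL (fun x => by rw [hex.choose_spec.2, h]) 1 0

theorem logInc_neg (g L : ℝ → ℂ) (hL : Continuous L) (h : ∀ x, Complex.exp (L x) = - g x) :
    logInc g = L 1 - L 0 := by
  have := logInc_eq g (fun x => L x + Real.pi * Complex.I) (by fun_prop) (by
    intro x; rw [Complex.exp_add, h, Complex.exp_pi_mul_I]; ring)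
  rw [this]; ring

/-- The plane `ℝ × ℝ` as the complex plane. -/
noncomputable def toC (p : ℝ × ℝ) : ℂ := Complex.equivRealProdCLM.symm p

theorem toC_cont : Continuous toC := Complex.equivRealProdCLM.symm.continuous

theorem toC_inj {p q : ℝ × ℝ} (h : toC p = toC q) : p = q :=
  Complex.equivRealProdCLM.symm.injective h

theorem parity_contra (x y : Fin 3 → Fin 3 → Fin 3 → ℤ)
    (h1 : ∀ i k j l : Fin 3, i < k → j < l →
      x i k l + y l i j - x k i j - y j k l = 1)
    (h0 : ∀ i k j l : Fin 3, i < k → l < j →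
      x i k l + y l i j - x k i j - y j k l = 0) : False := by
  have a1 := h1 0 1 0 1 (by decide) (by decide)
  have a2 := h1 0 1 0 2 (by decide) (by decide)
  have a3 := h1 0 1 1 2 (by decide) (by decide)
  have a4 := h1 0 2 0 1 (by decide) (by decide)
  have a5 := h1 0 2 0 2 (by decide) (by decide)
  have a6 := h1 0 2 1 2 (by decide) (by decide)
  have a7 := h1 1 2 0 1 (by decide) (by decide)
  have a8 := h1 1 2 0 2 (by decide) (by decide)
  have a9 := h1 1 2 1 2 (by decide) (by decide)
  have b1 := h0 0 1 1 0 (by decide) (by decide)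
  have b2 := h0 0 1 2 0 (by decide) (by decide)
  have b3 := h0 0 1 2 1 (by decide) (by decide)
  have b4 := h0 0 2 1 0 (by decide) (by decide)
  have b5 := h0 0 2 2 0 (by decide) (by decide)
  have b6 := h0 0 2 2 1 (by decide) (by decide)
  have b7 := h0 1 2 1 0 (by decide) (by decide)
  have b8 := h0 1 2 2 0 (by decide) (by decide)
  have b9 := h0 1 2 2 1 (by decide) (by decide)
  clear h1 h0
  omega

/-- A piece of `exp` bookkeeping. -/
theorem exp_int (u v : ℂ) (h : Complex.exp u = Complex.exp v) :
    ∃ n : ℤ, u = v + 2 * n * (Real.pi * Complex.I) := by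
  obtain ⟨n, hn⟩ := Complex.exp_eq_exp_iff_exists_int.1 h
  exact ⟨n, by rw [hn]; ring⟩

/-- Nonplanarity of `K₃,₃` in the strong (van Kampen) form: only vertex-disjoint
edges need to be disjoint. -/
theorem k33_param (a b : Fin 3 → ℝ × ℝ) (e : Fin 3 → Fin 3 → ℝ → ℝ × ℝ)
    (hc : ∀ i j, Continuous (e i j)) (h0 : ∀ i j, e i j 0 = a i) (h1 : ∀ i j, e i j 1 = b j)
    (hd : ∀ i j k l, i ≠ k → j ≠ l → ∀ s t, e i j s ≠ e k l t) : False := by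
  have hL : ∀ i j k l, i ≠ k → j ≠ l → ∃ L : ℝ × ℝ → ℂ, Continuous L ∧
      ∀ x, Complex.exp (L x) = toC (e i j x.1) - toC (e k l x.2) := by
    intro i j k l hik hjl
    refine exists_log_plane _ ?_ ?_
    · exact (toC_cont.comp ((hc i j).comp continuous_fst)).sub
        (toC_cont.comp ((hc k l).comp continuous_snd))
    · intro x h
      exact hd i j k l hik hjl _ _ (toC_inj (sub_eq_zero.1 h))
  -- increments
  let X : Fin 3 → Fin 3 → Fin 3 → ℂ := fun k i j => logInc fun s => toC (e i j s) - toC (a k)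
  let Y : Fin 3 → Fin 3 → Fin 3 → ℂ := fun l i j => logInc fun s => toC (e i j s) - toC (b l)
  have key : ∀ i j k l, i ≠ k → j ≠ l →
      X k i j + Y j k l = X i k l + Y l i j ∧
      Complex.exp (X k i j) = (toC (b j) - toC (a k)) / (toC (a i) - toC (a k)) ∧
      Complex.exp (Y l i j) = (toC (b j) - toC (b l)) / (toC (a i) - toC (b l)) := by
    intro i j k l hik hjl
    obtain ⟨L, hLc, hLe⟩ := hL i j k l hik hjl
    have e1 : X k i j = L (1, 0) - L (0, 0) :=
      logInc_eq _ (fun s => L (s, 0)) (by fun_prop) (fun s => by rw [hLe]; simp [h0])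
    have e2 : Y l i j = L (1, 1) - L (0, 1) :=
      logInc_eq _ (fun s => L (s, 1)) (by fun_prop) (fun s => by rw [hLe]; simp [h1])
    have e3 : X i k l = L (0, 1) - L (0, 0) :=
      logInc_neg _ (fun s => L (0, s)) (by fun_prop) (fun s => by rw [hLe]; simp [h0])
    have e4 : Y j k l = L (1, 1) - L (1, 0) :=
      logInc_neg _ (fun s => L (1, s)) (by fun_prop) (fun s => by rw [hLe]; simp [h1])
    refine ⟨by rw [e1, e2, e3, e4]; ring, ?_, ?_⟩
    · rw [e1, Complex.exp_sub, hLe, hLe]; simp [h0, h1]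
    · rw [e2, Complex.exp_sub, hLe, hLe]; simp [h0, h1]
  -- all vertices are distinct
  have other : ∀ j : Fin 3, ∃ l, j ≠ l := by decide
  have hab : ∀ k j, toC (b j) - toC (a k) ≠ 0 := by
    intro k j h
    obtain ⟨i, hi⟩ := other k
    obtain ⟨l, hl⟩ := other j
    refine hd i j k l hi.symm hl 1 0 ?_
    rw [h1, h0]; exact toC_inj (sub_eq_zero.1 h)
  have haa : ∀ i k, i ≠ k → toC (a i) - toC (a k) ≠ 0 := by
    intro i k hik h
    refine hd i 0 k 1 hik (by decide) 0 0 ?_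
    rw [h0, h0]; exact toC_inj (sub_eq_zero.1 h)
  have hbb : ∀ j l, j ≠ l → toC (b j) - toC (b l) ≠ 0 := by
    intro i k hik h
    refine hd 0 i 1 k (by decide) hik 1 1 ?_
    rw [h1, h1]; exact toC_inj (sub_eq_zero.1 h)
  let P : ℂ := Real.pi * Complex.I
  have hP : Complex.exp P = -1 := Complex.exp_pi_mul_I
  have hP0 : P ≠ 0 := by simp [P, Real.pi_ne_zero]
  -- chosen logarithms: `α k i` of `a i - a k`, `β l j` of `b j - b l`, `γ k j` of `b j - a k`
  let α : Fin 3 → Fin 3 → ℂ := fun k i =>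
    if k < i then Complex.log (toC (a k) - toC (a i)) + P else Complex.log (toC (a i) - toC (a k))
  let β : Fin 3 → Fin 3 → ℂ := fun k i =>
    if k < i then Complex.log (toC (b k) - toC (b i)) + P else Complex.log (toC (b i) - toC (b k))
  let γ : Fin 3 → Fin 3 → ℂ := fun k j => Complex.log (toC (b j) - toC (a k))
  have hα : ∀ k i, i ≠ k → Complex.exp (α k i) = toC (a i) - toC (a k) := by
    intro k i h
    simp only [α]
    split_ifs
    · rw [Complex.exp_add, Complex.exp_log (haa _ _ h.symm), hP]; ring
    · rw [Complex.exp_log (haa _ _ h)]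
  have hβ : ∀ k i, i ≠ k → Complex.exp (β k i) = toC (b i) - toC (b k) := by
    intro k i h
    simp only [β]
    split_ifs
    · rw [Complex.exp_add, Complex.exp_log (hbb _ _ h.symm), hP]; ring
    · rw [Complex.exp_log (hbb _ _ h)]
  have hγ : ∀ k j, Complex.exp (γ k j) = toC (b j) - toC (a k) := fun k j =>
    Complex.exp_log (hab _ _)
  have hαs : ∀ i k, i < k → α i k = α k i + P := by
    intro i k h; simp only [α]; rw [if_pos h, if_neg (by omega)]
  have hβs : ∀ i k, i < k → β i k = β k i + P := by
    intro i k h; simp only [β]; rw [if_pos h, if_neg (by omega)]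
  have hx : ∀ k i j, ∃ n : ℤ, i ≠ k → X k i j = γ k j - α k i + 2 * n * P := by
    intro k i j
    by_cases h : i = k
    · exact ⟨0, fun h' => absurd h h'⟩
    obtain ⟨l, hl⟩ := other j
    obtain ⟨n, hn⟩ := exp_int (X k i j) (γ k j - α k i) (by
      rw [(key i j k l h hl).2.1, Complex.exp_sub, hγ, hα _ _ h])
    exact ⟨n, fun _ => hn⟩
  have hy : ∀ l i j, ∃ n : ℤ, j ≠ l → Y l i j = β l j - γ i l - P + 2 * n * P := by
    intro l i j
    by_cases h : j = l
    · exact ⟨0, fun h' => absurd h h'⟩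
    obtain ⟨k, hk⟩ := other i
    obtain ⟨n, hn⟩ := exp_int (Y l i j) (β l j - γ i l - P) (by
      rw [(key i j k l hk h).2.2, Complex.exp_sub, Complex.exp_sub, hγ, hβ _ _ h, hP,
        ← neg_sub (toC (b l)) (toC (a i)), div_neg, div_neg, div_one])
    exact ⟨n, fun _ => hn⟩
  choose x hx using hx
  choose y hy using hy
  have fin : ∀ i k j l, i ≠ k → j ≠ l →
      (α i k - α k i) + (β j l - β l j) =
        2 * ((x i k l + y l i j - x k i j - y j k l : ℤ) : ℂ) * P := by
    intro i k j l hik hjl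
    have h := (key i j k l hik hjl).1
    rw [hx k i j hik, hy j k l hjl.symm, hx i k l hik.symm, hy l i j hjl] at h
    push_cast
    linear_combination h
  refine parity_contra x y ?_ ?_
  · intro i k j l hik hjl
    have h := fin i k j l hik.ne hjl.ne
    rw [hαs i k hik, hβs j l hjl] at h
    have h2 : (2 * P) * (((x i k l + y l i j - x k i j - y j k l : ℤ) : ℂ) - ((1 : ℤ) : ℂ)) = 0 := by
      push_cast at h ⊢
      linear_combination -h
    have h3 := (mul_eq_zero.1 h2).resolve_left (by simp [hP0])
    exact Int.cast_injective (sub_eq_zero.1 h3)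
  · intro i k j l hik hjl
    have h := fin i k j l hik.ne hjl.ne'
    rw [hαs i k hik, hβs l j hjl] at h
    have h2 : (2 * P) * (((x i k l + y l i j - x k i j - y j k l : ℤ) : ℂ) - ((0 : ℤ) : ℂ)) = 0 := by
      push_cast at h ⊢
      linear_combination -h
    have h3 := (mul_eq_zero.1 h2).resolve_left (by simp [hP0])
    exact Int.cast_injective (sub_eq_zero.1 h3)

theorem k33 (a b : Fin 3 → ℝ × ℝ) (E : Fin 3 → Fin 3 → Set (ℝ × ℝ))
    (hE : ∀ i j, JoinedIn (E i j) (a i) (b j))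
    (hd : ∀ i j k l, i < k → j ≠ l → Disjoint (E i j) (E k l)) : False := by
  have hd' : ∀ i j k l, i ≠ k → j ≠ l → Disjoint (E i j) (E k l) := by
    intro i j k l h h'
    rcases lt_or_gt_of_ne h with h | h
    · exact hd _ _ _ _ h h'
    · exact (hd _ _ _ _ h h'.symm).symm
  choose γ hγ using hE
  refine k33_param a b (fun i j => (γ i j).extend) (fun i j => (γ i j).continuous_extend)
    (by simp) (by simp) ?_
  intro i j k l h h' s t he
  have hm : ∀ i j s, (γ i j).extend s ∈ E i j := by
    intro i j s
    have : (γ i j).extend s ∈ range (γ i j) := by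
      rw [← Path.extend_range]; exact mem_range_self _
    obtain ⟨u, hu⟩ := this
    rw [← hu]; exact hγ i j u
  exact (Set.disjoint_left.1 (hd' i j k l h h')) (hm i j s) (by rw [he]; exact hm k l t)

/-- Parametrisation of a simple closed curve by `[0,1]` starting at a prescribed point. -/
theorem exists_param (C : Set (ℝ × ℝ)) (hC : IsSimpleClosedCurve C) (p : ℝ × ℝ) (hp : p ∈ C) :
    ∃ F : ℝ → ℝ × ℝ, Continuous F ∧ F 0 = p ∧ F 1 = p ∧ InjOn F (Ico 0 1) ∧
      F '' Icc 0 1 = C := by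
  obtain ⟨f, hf, rfl⟩ := hC
  obtain ⟨α, rfl⟩ := hp
  refine ⟨fun t => f ((t : AddCircle (1 : ℝ)) + α), ?_, by simp, ?_, ?_, ?_⟩
  · have : Continuous fun t : ℝ => (t : AddCircle (1 : ℝ)) := AddCircle.continuous_mk' 1
    fun_prop
  · simp only [AddCircle.coe_period, zero_add]
  · intro s hs t ht h
    have h2 := add_right_cancel (hf h)
    exact (AddCircle.coe_eq_coe_iff_of_mem_Ico (a := (0 : ℝ)) (p := (1 : ℝ))
      (by simpa using hs) (by simpa using ht)).1 h2
  · ext z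
    constructor
    · rintro ⟨t, -, rfl⟩; exact mem_range_self _
    · rintro ⟨u, rfl⟩
      have hu : u - α ∈ ((↑) : ℝ → AddCircle (1 : ℝ)) '' Icc 0 (0 + 1) := by
        rw [AddCircle.coe_image_Icc_eq]; trivial
      obtain ⟨t, ht, htu⟩ := hu
      refine ⟨t, by simpa using ht, ?_⟩
      simp only
      rw [htu, sub_add_cancel]

/-- Injectivity of the parametrisation, in a convenient form. -/
theorem param_inj {F : ℝ → ℝ × ℝ} (h01 : F 0 = F 1) (hinj : InjOn F (Ico 0 1)) {s t : ℝ}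
    (hs : s ∈ Icc (0 : ℝ) 1) (ht : t ∈ Icc (0 : ℝ) 1) (h : F s = F t) :
    s = t ∨ (s = 0 ∧ t = 1) ∨ (s = 1 ∧ t = 0) := by
  rcases hs.2.lt_or_eq with h1 | h1 <;> rcases ht.2.lt_or_eq with h2 | h2
  · exact Or.inl (hinj ⟨hs.1, h1⟩ ⟨ht.1, h2⟩ h)
  · subst h2
    have := hinj ⟨hs.1, h1⟩ ⟨le_rfl, one_pos⟩ (h.trans h01.symm)
    exact Or.inr (Or.inl ⟨this, rfl⟩)
  · subst h1
    have := hinj ⟨ht.1, h2⟩ ⟨le_rfl, one_pos⟩ (h.symm.trans h01.symm)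
    exact Or.inr (Or.inr ⟨rfl, this⟩)
  · exact Or.inl (h1.trans h2.symm)

/-- An arc does not bound an open set. -/
theorem arc_no_bounded (F : ℝ → ℝ × ℝ) (hF : Continuous F) (c d : ℝ) (hcd : c ≤ d)
    (hinj : InjOn F (Icc c d)) (W : Set (ℝ × ℝ)) (hb : Bornology.IsBounded W)
    (hne : W.Nonempty) (hdis : Disjoint W (F '' Icc c d)) (hfr : frontier W ⊆ F '' Icc c d) :
    False := by
  classical
  -- retraction
  have hemb : Topology.IsClosedEmbedding (fun t : Icc c d => F t) :=
    (hF.comp continuous_subtype_val).isClosedEmbedding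
      (fun s t h => Subtype.ext (hinj s.2 t.2 h))
  obtain ⟨g, hg⟩ := ContinuousMap.exists_extension' (Y := ℝ) hemb
    (⟨fun t : Icc c d => (t : ℝ), by fun_prop⟩ : C(Icc c d, ℝ))
  have hg' : ∀ t ∈ Icc c d, g (F t) = t := fun t ht => congrFun hg ⟨t, ht⟩
  let r : ℝ × ℝ → ℝ × ℝ := fun z => F (projIcc c d hcd (g z))
  have hr : Continuous r :=
    hF.comp (continuous_subtype_val.comp (continuous_projIcc.comp g.continuous))
  have hrK : ∀ z, r z ∈ F '' Icc c d := fun z => ⟨_, (projIcc c d hcd (g z)).2, rfl⟩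
  have hrid : ∀ z ∈ F '' Icc c d, r z = z := by
    rintro _ ⟨t, ht, rfl⟩
    simp only [r]
    rw [hg' t ht, projIcc_of_mem hcd ht]
  let h : ℝ × ℝ → ℝ × ℝ := fun z => if z ∈ W then r z else z
  have hh : Continuous h := Continuous.if (fun z hz => hrid z (hfr hz)) hr continuous_id
  obtain ⟨a, ha⟩ := hne
  have hha : ∀ z, h z ≠ a := by
    intro z hz
    simp only [h] at hz
    split_ifs at hz with hzW
    · exact disjoint_left.1 hdis ha (hz ▸ hrK z)
    · exact hzW (hz ▸ ha)
  obtain ⟨L, hL, hLe⟩ := exists_log_plane (fun z => toC (h z) - toC a)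
    ((toC_cont.comp hh).sub continuous_const)
    (fun z hz => hha z (toC_inj (sub_eq_zero.1 hz)))
  have hbd : Bornology.IsBounded (toC '' W) :=
    ((hb.isCompact_closure.image toC_cont).isBounded).subset (image_mono subset_closure)
  obtain ⟨R, hR⟩ := hbd.subset_ball (toC a)
  have hR0 : 0 < R := by
    have := hR ⟨a, ha, rfl⟩
    simpa using this
  let ci : ℝ → ℝ × ℝ := fun θ =>
    Complex.equivRealProdCLM (toC a + R * Complex.exp (θ * Complex.I))
  have hci : Continuous ci := by
    refine Complex.equivRealProdCLM.continuous.comp ?_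
    fun_prop
  have htc : ∀ θ, toC (ci θ) = toC a + R * Complex.exp (θ * Complex.I) := fun θ =>
    Complex.equivRealProdCLM.symm_apply_apply _
  have hciW : ∀ θ, ci θ ∉ W := by
    intro θ hθ
    have := hR ⟨_, hθ, rfl⟩
    rw [htc, Metric.mem_ball, dist_eq_norm, add_sub_cancel_left, norm_mul,
      Complex.norm_exp_ofReal_mul_I] at this
    simp [abs_of_pos hR0] at this
  have := log_diff (fun θ : ℝ => L (ci θ)) (fun θ : ℝ => (Real.log R : ℂ) + θ * Complex.I)
    (hL.comp hci) (by fun_prop) (fun θ => by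
      rw [hLe, Complex.exp_add, ← Complex.ofReal_exp, Real.exp_log hR0]
      simp only [h]
      rw [if_neg (hciW θ), htc]; ring) (2 * Real.pi) 0
  have hper : ci (2 * Real.pi) = ci 0 := by
    simp only [ci]
    push_cast
    rw [Complex.exp_two_pi_mul_I]; simp
  rw [hper] at this
  simp [Real.pi_ne_zero] at this

theorem seg_joined {S : Set (ℝ × ℝ)} {x y : ℝ × ℝ} (h : segment ℝ x y ⊆ S) : JoinedIn S x y :=
  JoinedIn.of_segment_subset h

theorem arc_joined {F : ℝ → ℝ × ℝ} (hF : Continuous F) {c d : ℝ} (h : c ≤ d) :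
    JoinedIn (F '' Icc c d) (F c) (F d) :=
  (((convex_Icc c d).isPathConnected ⟨c, le_rfl, h⟩).image hF).joinedIn _
    ⟨c, ⟨le_rfl, h⟩, rfl⟩ _ ⟨d, ⟨h, le_rfl⟩, rfl⟩

theorem curve_compact {C : Set (ℝ × ℝ)} (hC : IsSimpleClosedCurve C) : IsCompact C := by
  obtain ⟨f, -, rfl⟩ := hC
  exact isCompact_range f.continuous

/-- A simple closed curve is not contained in a vertical line. -/
theorem curve_not_vertical {C : Set (ℝ × ℝ)} (hC : IsSimpleClosedCurve C) (p : ℝ × ℝ) (hp : p ∈ C)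
    (h : ∀ z ∈ C, z.1 = p.1) : False := by
  obtain ⟨G, hG, h0, h1, hinj, him⟩ := exists_param C hC p hp
  have hv : Continuous fun t => (G t).2 := continuous_snd.comp hG
  have hmem : ∀ t ∈ Icc (0 : ℝ) 1, (G t).1 = p.1 := fun t ht => h _ (him ▸ ⟨t, ht, rfl⟩)
  have hne : (G 0).2 ≠ (G (1 / 2)).2 := by
    intro h2
    have h3 : G 0 = G (1 / 2) := Prod.ext (by
      rw [hmem 0 (by norm_num), hmem (1 / 2) (by norm_num)]) h2
    have := hinj (by norm_num) (by norm_num) h3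
    norm_num at this
  have h12 : (G 1).2 = (G 0).2 := by rw [h1, h0]
  set m := ((G 0).2 + (G (1 / 2)).2) / 2 with hm
  have hmid : m ∈ uIcc ((G 0).2) ((G (1 / 2)).2) := by
    rw [mem_uIcc]
    rcases le_total (G 0).2 (G (1 / 2)).2 with h | h
    · left; constructor <;> linarith
    · right; constructor <;> linarith
  have hmid2 : m ∈ uIcc ((G (1 / 2)).2) ((G 1).2) := by
    rw [h12, uIcc_comm]; exact hmid
  obtain ⟨t1, ht1, e1⟩ := intermediate_value_uIcc hv.continuousOn hmid
  obtain ⟨t2, ht2, e2⟩ := intermediate_value_uIcc hv.continuousOn hmid2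
  rw [uIcc_of_le (by norm_num)] at ht1 ht2
  have m1 : t1 ∈ Icc (0 : ℝ) 1 := ⟨ht1.1, by linarith [ht1.2]⟩
  have m2 : t2 ∈ Icc (0 : ℝ) 1 := ⟨by linarith [ht2.1], ht2.2⟩
  simp only at e1 e2
  have he : G t1 = G t2 := Prod.ext (by rw [hmem _ m1, hmem _ m2]) (by rw [e1, e2])
  have hne2 : (G 0).2 - (G (1 / 2)).2 ≠ 0 := sub_ne_zero.2 hne
  rcases param_inj (h0.trans h1.symm) hinj m1 m2 he with h | h | h
  · have : t1 = 1 / 2 := le_antisymm ht1.2 (h ▸ ht2.1)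
    rw [this] at e1
    apply hne2; linarith
  · rw [h.1] at e1
    apply hne2; linarith
  · have := ht1.2
    rw [h.1] at this; norm_num at this

/-- A simple closed curve separates the plane. -/
theorem curve_separates {C : Set (ℝ × ℝ)} (hC : IsSimpleClosedCurve C) :
    ∃ x y, x ∉ C ∧ y ∉ C ∧ ¬ JoinedIn Cᶜ x y := by
  have hcomp := curve_compact hC
  have hCne : C.Nonempty := by
    obtain ⟨f, -, rfl⟩ := hC
    exact range_nonempty f
  obtain ⟨p, hp, hpmin⟩ := hcomp.exists_isMinOn hCne continuous_fst.continuousOn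
  obtain ⟨q, hq, hqmax⟩ := hcomp.exists_isMaxOn hCne continuous_fst.continuousOn
  obtain ⟨w, hw, hwmax⟩ := hcomp.exists_isMaxOn hCne continuous_snd.continuousOn
  have hpl : ∀ z ∈ C, p.1 ≤ z.1 := fun z hz => hpmin hz
  have hqr : ∀ z ∈ C, z.1 ≤ q.1 := fun z hz => hqmax hz
  have hwt : ∀ z ∈ C, z.2 ≤ w.2 := fun z hz => hwmax hz
  have hpq : p.1 < q.1 := by
    by_contra hcon
    exact curve_not_vertical hC p hp fun z hz =>
      le_antisymm ((hqr z hz).trans (not_lt.1 hcon)) (hpl z hz)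
  obtain ⟨F, hF, h0, h1, hinj, him⟩ := exists_param C hC p hp
  have hFC : ∀ t ∈ Icc (0 : ℝ) 1, F t ∈ C := fun t ht => him ▸ ⟨t, ht, rfl⟩
  have hpi := @param_inj F (h0.trans h1.symm) hinj
  obtain ⟨β, hβ, hβq⟩ : q ∈ F '' Icc 0 1 := him ▸ hq
  have hβ0 : 0 < β := by
    refine lt_of_le_of_ne hβ.1 ?_
    rintro rfl
    rw [← hβq, h0] at hpq; exact lt_irrefl _ hpq
  have hβ1 : β < 1 := by
    refine lt_of_le_of_ne hβ.2 ?_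
    rintro rfl
    rw [← hβq, h1] at hpq; exact lt_irrefl _ hpq
  set m := (p.1 + q.1) / 2 with hm
  have hpm : p.1 < m := by linarith
  have hmq : m < q.1 := by linarith
  have hF1 : Continuous fun t => (F t).1 := continuous_fst.comp hF
  have hF2 : Continuous fun t => (F t).2 := continuous_snd.comp hF
  have hcl : IsClosed {t | (F t).1 = m} := isClosed_eq hF1 continuous_const
  have hS1 : (Icc 0 β ∩ {t | (F t).1 = m}).Nonempty := by
    obtain ⟨t, ht, e⟩ := intermediate_value_Icc hβ0.le hF1.continuousOn
      (show m ∈ Icc ((F 0).1) ((F β).1) by rw [h0, hβq]; exact ⟨hpm.le, hmq.le⟩)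
    exact ⟨t, ht, e⟩
  have hS2 : (Icc β 1 ∩ {t | (F t).1 = m}).Nonempty := by
    obtain ⟨t, ht, e⟩ := intermediate_value_Icc' hβ1.le hF1.continuousOn
      (show m ∈ Icc ((F 1).1) ((F β).1) by rw [h1, hβq]; exact ⟨hpm.le, hmq.le⟩)
    exact ⟨t, ht, e⟩
  obtain ⟨⟨t1, t2⟩, ⟨⟨ht1, e1⟩, ⟨ht2, e2⟩⟩, hmin⟩ :=
    ((isCompact_Icc.inter_right hcl).prod (isCompact_Icc.inter_right hcl)).exists_isMinOn
      (hS1.prod hS2) (f := fun z : ℝ × ℝ => |(F z.1).2 - (F z.2).2|)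
      (by fun_prop)
  simp only [mem_ofPred_eq] at ht1 e1 ht2 e2
  have hmin' : ∀ u1 ∈ Icc 0 β, (F u1).1 = m → ∀ u2 ∈ Icc β 1, (F u2).1 = m →
      |(F t1).2 - (F t2).2| ≤ |(F u1).2 - (F u2).2| := fun u1 a1 b1 u2 a2 b2 =>
    hmin (show (u1, u2) ∈ _ from ⟨⟨a1, b1⟩, ⟨a2, b2⟩⟩)
  have t1pos : 0 < t1 := by
    refine lt_of_le_of_ne ht1.1 ?_
    rintro rfl; rw [h0] at e1; exact hpm.ne e1
  have t1β : t1 < β := by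
    refine lt_of_le_of_ne ht1.2 ?_
    rintro rfl; rw [hβq] at e1; exact hmq.ne' e1
  have t2β : β < t2 := by
    refine lt_of_le_of_ne ht2.1 ?_
    rintro rfl; rw [hβq] at e2; exact hmq.ne' e2
  have t2one : t2 < 1 := by
    refine lt_of_le_of_ne ht2.2 ?_
    rintro rfl; rw [h1] at e2; exact hpm.ne e2
  set y1 := (F t1).2 with hy1
  set y2 := (F t2).2 with hy2
  have hyne : y1 ≠ y2 := by
    intro h
    have h3 : F t1 = F t2 := Prod.ext (e1.trans e2.symm) h
    rcases hpi ⟨ht1.1, by linarith⟩ ⟨by linarith, ht2.2⟩ h3 with h | h | h <;> linarith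
  have hypos : 0 < |y1 - y2| := abs_pos.2 (sub_ne_zero.2 hyne)
  let G : ℝ → ℝ × ℝ := fun l => (m, y1 + l * (y2 - y1))
  have hG : Continuous G := by fun_prop
  have hG0 : G 0 = F t1 := Prod.ext e1.symm (by simp [G, hy1])
  have hG1 : G 1 = F t2 := Prod.ext e2.symm (by simp [G, hy2])
  have hGC : ∀ l ∈ Icc (0 : ℝ) 1, G l ∈ C → l = 0 ∨ l = 1 := by
    intro l hl hlC
    rw [← him] at hlC
    obtain ⟨t, ht, e⟩ := hlC
    have ea : (F t).1 = m := by rw [e]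
    have eb : (F t).2 = y1 + l * (y2 - y1) := by rw [e]
    rcases le_total t β with h | h
    · left
      have := hmin' t ⟨ht.1, h⟩ ea t2 ht2 e2
      rw [eb, ← hy2, show y1 + l * (y2 - y1) - y2 = (1 - l) * (y1 - y2) by ring, abs_mul,
        abs_of_nonneg (show 0 ≤ 1 - l by linarith [hl.2])] at this
      nlinarith [hl.1, hypos]
    · right
      have := hmin' t1 ht1 e1 t ⟨h, ht.2⟩ ea
      rw [eb, ← hy1, show y1 - (y1 + l * (y2 - y1)) = l * (y1 - y2) by ring, abs_mul,
        abs_of_nonneg hl.1] at this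
      nlinarith [hl.2]
  have hGtop : ∀ l ∈ Icc (0 : ℝ) 1, (G l).2 ≤ w.2 := by
    intro l hl
    have a1 : y1 ≤ w.2 := hwt _ (hFC t1 ⟨ht1.1, by linarith⟩)
    have a2 : y2 ≤ w.2 := hwt _ (hFC t2 ⟨by linarith, ht2.2⟩)
    simp only [G]
    nlinarith [hl.1, hl.2]
  have hxC : G (1 / 2) ∉ C := by
    intro h
    rcases hGC _ (by norm_num) h with h | h <;> norm_num at h
  refine ⟨G (1 / 2), (p.1 - 1, w.2 + 1), hxC, fun h => by
    have := hpl _ h; simp only at this; linarith, fun hJ => ?_⟩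
  -- outer edges
  let Ep : Set (ℝ × ℝ) := {p} ∪ {z | z.1 < p.1}
  let Eq : Set (ℝ × ℝ) := {q} ∪ ({z | q.1 < z.1} ∪ {z | w.2 < z.2})
  have jEp : JoinedIn Ep p (p.1 - 1, w.2 + 1) := by
    apply seg_joined
    rw [segment_eq_image']
    rintro _ ⟨θ, hθ, rfl⟩
    rcases hθ.1.eq_or_lt with h | h
    · left; rw [← h]; simp
    · right; simp; exact h
  have jEq : JoinedIn Eq q (p.1 - 1, w.2 + 1) := by
    have j1 : JoinedIn Eq q (q.1 + 1, w.2 + 1) := by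
      apply seg_joined
      rw [segment_eq_image']
      rintro _ ⟨θ, hθ, rfl⟩
      rcases hθ.1.eq_or_lt with h | h
      · left; rw [← h]; simp
      · right; left; simp; exact h
    have j2 : JoinedIn Eq (q.1 + 1, w.2 + 1) (p.1 - 1, w.2 + 1) := by
      apply seg_joined
      rw [segment_eq_image']
      rintro _ ⟨θ, hθ, rfl⟩
      right; right; simp
    exact j1.trans j2
  -- points of the curve on the outer edges
  have cEp : ∀ t ∈ Ioo (0 : ℝ) 1, F t ∉ Ep := by
    rintro t ht (h | h)
    · rw [mem_singleton_iff, ← h0] at h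
      rcases hpi ⟨ht.1.le, ht.2.le⟩ ⟨le_rfl, zero_le_one⟩ h with h | h | h
      · linarith [ht.1]
      · linarith [ht.1]
      · linarith [ht.2]
    · have := hpl _ (hFC t ⟨ht.1.le, ht.2.le⟩)
      exact absurd h (not_lt.2 this)
  have cEq : ∀ t ∈ Icc (0 : ℝ) 1, t ≠ β → F t ∉ Eq := by
    rintro t ht hne (h | h | h)
    · rw [mem_singleton_iff, ← hβq] at h
      rcases hpi ht hβ h with h | h | h
      · exact hne h
      · linarith
      · linarith
    · exact absurd h (not_lt.2 (hqr _ (hFC t ht)))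
    · exact absurd h (not_lt.2 (hwt _ (hFC t ht)))
  have gEp : ∀ l, G l ∉ Ep := by
    rintro l (h | h)
    · have : m = p.1 := congrArg Prod.fst h
      linarith
    · have : m < p.1 := h
      linarith
  have gEq : ∀ l ∈ Icc (0 : ℝ) 1, G l ∉ Eq := by
    rintro l hl (h | h | h)
    · have : m = q.1 := congrArg Prod.fst h
      linarith
    · have : q.1 < m := h
      linarith
    · exact absurd h (not_lt.2 (hGtop l hl))
  have GF1 : ∀ l ∈ Icc (0 : ℝ) (1 / 2), ∀ t ∈ Icc (0 : ℝ) 1, G l = F t → t = t1 := by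
    intro l hl t ht h
    rcases hGC l ⟨hl.1, by linarith [hl.2]⟩ (h ▸ hFC t ht) with h' | h'
    · rw [h', hG0] at h
      rcases hpi ⟨t1pos.le, by linarith⟩ ht h with h | h | h
      · exact h.symm
      · linarith
      · linarith
    · linarith [hl.2]
  have GF2 : ∀ l ∈ Icc (1 / 2 : ℝ) 1, ∀ t ∈ Icc (0 : ℝ) 1, G l = F t → t = t2 := by
    intro l hl t ht h
    rcases hGC l ⟨by linarith [hl.1], hl.2⟩ (h ▸ hFC t ht) with h' | h'
    · linarith [hl.1]
    · rw [h', hG1] at h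
      rcases hpi ⟨by linarith, by linarith⟩ ht h with h | h | h
      · exact h.symm
      · linarith
      · linarith
  have sub : ∀ c d : ℝ, 0 ≤ c → d ≤ 1 → F '' Icc c d ⊆ C := by
    rintro c d hc hd _ ⟨t, ht, rfl⟩
    exact hFC t ⟨hc.trans ht.1, ht.2.trans hd⟩
  -- the disjointness facts
  have d1 : Disjoint (F '' Icc 0 t1) (F '' Icc β t2) := by
    rw [disjoint_left]
    rintro _ ⟨s, hs, rfl⟩ ⟨t, ht, h⟩
    rcases hpi ⟨by linarith [ht.1], by linarith [ht.2]⟩ ⟨hs.1, by linarith [hs.2]⟩ h with h | h | h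
    · linarith [hs.2, ht.1]
    · linarith [h.1, ht.1]
    · linarith [h.1, ht.2]
  have d2 : Disjoint (F '' Icc 0 t1) Eq := by
    rw [disjoint_left]
    rintro _ ⟨s, hs, rfl⟩
    exact cEq s ⟨hs.1, by linarith [hs.2]⟩ (by linarith [hs.2])
  have d3 : Disjoint (F '' Icc 0 t1) (G '' Icc (1 / 2) 1) := by
    rw [disjoint_left]
    rintro _ ⟨s, hs, rfl⟩ ⟨l, hl, h⟩
    have := GF2 l hl s ⟨hs.1, by linarith [hs.2]⟩ h
    linarith [hs.2]
  have d4 : Disjoint (F '' Icc 0 t1) Cᶜ :=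
    disjoint_compl_right_iff_subset.2 (sub _ _ le_rfl (by linarith))
  have d5 : Disjoint (F '' Icc t2 1) (F '' Icc t1 β) := by
    rw [disjoint_left]
    rintro _ ⟨s, hs, rfl⟩ ⟨t, ht, h⟩
    rcases hpi ⟨by linarith [ht.1], by linarith [ht.2]⟩ ⟨by linarith [hs.1], hs.2⟩ h with h | h | h
    · linarith [hs.1, ht.2]
    · linarith [h.1, ht.1]
    · linarith [h.1, ht.2]
  have d6 : Disjoint (F '' Icc t2 1) Eq := by
    rw [disjoint_left]
    rintro _ ⟨s, hs, rfl⟩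
    exact cEq s ⟨by linarith [hs.1], hs.2⟩ (by linarith [hs.1])
  have d7 : Disjoint (F '' Icc t2 1) (G '' Icc 0 (1 / 2)) := by
    rw [disjoint_left]
    rintro _ ⟨s, hs, rfl⟩ ⟨l, hl, h⟩
    have := GF1 l hl s ⟨by linarith [hs.1], hs.2⟩ h
    linarith [hs.1]
  have d8 : Disjoint (F '' Icc t2 1) Cᶜ :=
    disjoint_compl_right_iff_subset.2 (sub _ _ (by linarith) le_rfl)
  have d9 : Disjoint Ep (F '' Icc t1 β) := by
    rw [disjoint_right]
    rintro _ ⟨s, hs, rfl⟩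
    exact cEp s ⟨by linarith [hs.1], by linarith [hs.2]⟩
  have d10 : Disjoint Ep (F '' Icc β t2) := by
    rw [disjoint_right]
    rintro _ ⟨s, hs, rfl⟩
    exact cEp s ⟨by linarith [hs.1], by linarith [hs.2]⟩
  have d11 : Disjoint Ep (G '' Icc 0 (1 / 2)) := by
    rw [disjoint_right]
    rintro _ ⟨s, hs, rfl⟩
    exact gEp s
  have d12 : Disjoint Ep (G '' Icc (1 / 2) 1) := by
    rw [disjoint_right]
    rintro _ ⟨s, hs, rfl⟩
    exact gEp s
  have d13 : Disjoint (F '' Icc t1 β) (G '' Icc (1 / 2) 1) := by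
    rw [disjoint_left]
    rintro _ ⟨s, hs, rfl⟩ ⟨l, hl, h⟩
    have := GF2 l hl s ⟨by linarith [hs.1], by linarith [hs.2]⟩ h
    linarith [hs.2]
  have d14 : Disjoint (F '' Icc t1 β) Cᶜ :=
    disjoint_compl_right_iff_subset.2 (sub _ _ (by linarith) (by linarith))
  have d15 : Disjoint (F '' Icc β t2) (G '' Icc 0 (1 / 2)) := by
    rw [disjoint_left]
    rintro _ ⟨s, hs, rfl⟩ ⟨l, hl, h⟩
    have := GF1 l hl s ⟨by linarith [hs.1], by linarith [hs.2]⟩ h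
    linarith [hs.1]
  have d16 : Disjoint (F '' Icc β t2) Cᶜ :=
    disjoint_compl_right_iff_subset.2 (sub _ _ (by linarith) (by linarith))
  have d17 : Disjoint Eq (G '' Icc 0 (1 / 2)) := by
    rw [disjoint_right]
    rintro _ ⟨s, hs, rfl⟩
    exact gEq s ⟨hs.1, by linarith [hs.2]⟩
  have d18 : Disjoint Eq (G '' Icc (1 / 2) 1) := by
    rw [disjoint_right]
    rintro _ ⟨s, hs, rfl⟩
    exact gEq s ⟨by linarith [hs.1], hs.2⟩
  refine k33 ![p, q, G (1 / 2)] ![F t1, F t2, (p.1 - 1, w.2 + 1)]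
    ![![F '' Icc 0 t1, F '' Icc t2 1, Ep], ![F '' Icc t1 β, F '' Icc β t2, Eq],
      ![G '' Icc 0 (1 / 2), G '' Icc (1 / 2) 1, Cᶜ]] ?_ ?_
  · have j1 := arc_joined hF ht1.1
    have j2 := (arc_joined hF ht2.2).symm
    have j3 := (arc_joined hF ht1.2).symm
    have j4 := arc_joined hF ht2.1
    have j5 := (arc_joined hG (c := 0) (d := 1 / 2) (by norm_num)).symm
    have j6 := arc_joined hG (c := 1 / 2) (d := 1) (by norm_num)
    rw [h0] at j1
    rw [h1] at j2
    rw [hβq] at j3 j4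
    rw [hG0] at j5
    rw [hG1] at j6
    intro i j
    fin_cases i <;> fin_cases j
    exacts [j1, j2, jEp, j3, j4, jEq, j5, j6, hJ]
  · intro i j k l hik hjl
    fin_cases i <;> fin_cases k <;> first
      | (exact absurd hik (by decide))
      | (fin_cases j <;> fin_cases l <;> first
          | (exact absurd rfl hjl)
          | assumption)

/-- The exterior of a square is connected. -/
theorem exterior_preconnected (R : ℝ) :
    IsPreconnected ((({z : ℝ × ℝ | R < z.1} ∪ {z | R < z.2}) ∪ {z | z.1 < -R}) ∪ {z | z.2 < -R}) := by
  have c1 : Convex ℝ {z : ℝ × ℝ | R < z.1} :=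
    (convex_Ioi R).is_linear_preimage (LinearMap.fst ℝ ℝ ℝ).isLinear
  have c2 : Convex ℝ {z : ℝ × ℝ | R < z.2} :=
    (convex_Ioi R).is_linear_preimage (LinearMap.snd ℝ ℝ ℝ).isLinear
  have c3 : Convex ℝ {z : ℝ × ℝ | z.1 < -R} :=
    (convex_Iio (-R)).is_linear_preimage (LinearMap.fst ℝ ℝ ℝ).isLinear
  have c4 : Convex ℝ {z : ℝ × ℝ | z.2 < -R} :=
    (convex_Iio (-R)).is_linear_preimage (LinearMap.snd ℝ ℝ ℝ).isLinear
  have h1 : R < R + 1 := by linarith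
  have h2 : -R - 1 < -R := by linarith
  refine IsPreconnected.union (-R - 1, -R - 1) (Or.inr h2) h2
    (IsPreconnected.union (-R - 1, R + 1) (Or.inr h1) h2
      (IsPreconnected.union (R + 1, R + 1) h1 h1 c1.isPreconnected c2.isPreconnected)
      c3.isPreconnected) c4.isPreconnected

/-- The part of the Jordan curve theorem we need: off any given component of the complement
there is another one, whose closure contains the whole curve. -/
theorem jordan_other_side {C : Set (ℝ × ℝ)} (hC : IsSimpleClosedCurve C) (x0 : ℝ × ℝ)
    (hx0 : x0 ∉ C) : ∃ U : Set (ℝ × ℝ), IsOpen U ∧ IsConnected U ∧ Disjoint U C ∧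
      Disjoint U (connectedComponentIn Cᶜ x0) ∧ C ⊆ closure U := by
  have hCo : IsOpen Cᶜ := (curve_compact hC).isClosed.isOpen_compl
  set V := connectedComponentIn Cᶜ x0 with hV
  have hVo : IsOpen V := hCo.connectedComponentIn
  have hx0V : x0 ∈ V := mem_connectedComponentIn hx0
  obtain ⟨u, huC, huV⟩ : ∃ u, u ∉ C ∧ u ∉ V := by
    obtain ⟨x, y, hx, hy, hxy⟩ := curve_separates hC
    by_contra! hcon
    have hVp : IsPathConnected V := hVo.isConnected_iff_isPathConnected.1
      ⟨⟨x0, hx0V⟩, isPreconnected_connectedComponentIn⟩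
    exact hxy ((hVp.joinedIn x (hcon x hx) y (hcon y hy)).mono (connectedComponentIn_subset _ _))
  set U := connectedComponentIn Cᶜ u with hU
  have hUo : IsOpen U := hCo.connectedComponentIn
  have huU : u ∈ U := mem_connectedComponentIn huC
  have hUC : Disjoint U C := disjoint_left.2 fun z hz => connectedComponentIn_subset _ _ hz
  have hUV : Disjoint U V := by
    rw [disjoint_left]
    intro z hzU hzV
    apply huV
    rw [hV, connectedComponentIn_eq hzV, ← connectedComponentIn_eq hzU]
    exact huU
  have hfr : frontier U ⊆ C := by
    intro z hz
    by_contra hzC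
    have hzo : IsOpen (connectedComponentIn Cᶜ z) := hCo.connectedComponentIn
    have hzz : z ∈ connectedComponentIn Cᶜ z := mem_connectedComponentIn hzC
    obtain ⟨v, hv1, hv2⟩ := mem_closure_iff.1 (frontier_subset_closure hz) _ hzo hzz
    have hzU : z ∈ U := by
      rw [hU, connectedComponentIn_eq hv2, ← connectedComponentIn_eq hv1]; exact hzz
    rw [hUo.frontier_eq] at hz
    exact hz.2 hzU
  refine ⟨U, hUo, ⟨⟨u, huU⟩, isPreconnected_connectedComponentIn⟩, hUC, hUV, ?_⟩
  intro p hp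
  by_contra hpU
  obtain ⟨F, hF, h0, h1, hinj, him⟩ := exists_param C hC p hp
  have hpo : IsOpen (F ⁻¹' (closure U)ᶜ) := isClosed_closure.isOpen_compl.preimage hF
  obtain ⟨ε0, hε0, hb0⟩ := Metric.isOpen_iff.1 hpo 0 (by rw [mem_preimage, h0]; exact hpU)
  obtain ⟨ε1, hε1, hb1⟩ := Metric.isOpen_iff.1 hpo 1 (by rw [mem_preimage, h1]; exact hpU)
  obtain ⟨δ, hδ, hδ'⟩ : ∃ δ : ℝ, 0 < δ ∧ (δ ≤ ε0 ∧ δ ≤ ε1 ∧ δ ≤ 1 / 4) :=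
    ⟨min (min ε0 ε1) (1 / 4), by positivity,
      (min_le_left _ _).trans (min_le_left _ _), (min_le_left _ _).trans (min_le_right _ _),
      min_le_right _ _⟩
  obtain ⟨hδ0, hδ1, hδ4⟩ := hδ'
  have hinjK : InjOn F (Icc δ (1 - δ)) := by
    refine hinj.mono ?_
    intro t ht
    exact ⟨by linarith [ht.1], by linarith [ht.2]⟩
  set K := F '' Icc δ (1 - δ) with hK
  have hKC : K ⊆ C := by
    rintro _ ⟨t, ht, rfl⟩
    rw [← him]; exact ⟨t, ⟨by linarith [ht.1], by linarith [ht.2]⟩, rfl⟩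
  have hfrK : frontier U ⊆ K := by
    intro z hz
    obtain ⟨t, ht, rfl⟩ : z ∈ F '' Icc 0 1 := him ▸ hfr hz
    have hzc := frontier_subset_closure hz
    refine ⟨t, ⟨?_, ?_⟩, rfl⟩
    · by_contra hlt
      refine hb0 (show t ∈ Metric.ball 0 ε0 from ?_) hzc
      rw [Metric.mem_ball, Real.dist_eq, sub_zero, abs_of_nonneg ht.1]; linarith
    · by_contra hlt
      refine hb1 (show t ∈ Metric.ball 1 ε1 from ?_) hzc
      rw [Metric.mem_ball, Real.dist_eq, abs_sub_comm, abs_of_nonneg (by linarith [ht.2])]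
      linarith
  have hKcl : IsClosed K := (isCompact_Icc.image hF).isClosed
  by_cases hUb : Bornology.IsBounded U
  · exact arc_no_bounded F hF δ (1 - δ) (by linarith) hinjK U hUb ⟨u, huU⟩
      (hUC.mono_right hKC) hfrK
  · refine arc_no_bounded F hF δ (1 - δ) (by linarith) hinjK (closure U ∪ K)ᶜ ?_ ⟨x0, ?_⟩ ?_ ?_
    · obtain ⟨R, hR⟩ := (curve_compact hC).isBounded.subset_closedBall (0 : ℝ × ℝ)
      have habs : ∀ z : ℝ × ℝ, z ∈ Metric.closedBall (0 : ℝ × ℝ) R ↔ |z.1| ≤ R ∧ |z.2| ≤ R := by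
        intro z
        rw [mem_closedBall_zero_iff, Prod.norm_def, max_le_iff, Real.norm_eq_abs, Real.norm_eq_abs]
      set X := ((({z : ℝ × ℝ | R < z.1} ∪ {z | R < z.2}) ∪ {z | z.1 < -R}) ∪ {z | z.2 < -R})
        with hX
      have hXc : ∀ z, z ∈ X ↔ z ∉ Metric.closedBall (0 : ℝ × ℝ) R := by
        intro z
        rw [habs, abs_le, abs_le]
        simp only [hX, mem_union, mem_ofPred_eq]
        constructor
        · rintro (((h | h) | h) | h) ⟨⟨a, b⟩, c, d⟩ <;> linarith
        · intro h
          by_contra! hcon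
          exact h ⟨⟨hcon.1.2, hcon.1.1.1⟩, hcon.2, hcon.1.1.2⟩
      have hXC : X ⊆ Cᶜ := fun z hz hzC => (hXc z).1 hz (hR hzC)
      obtain ⟨v, hvU, hvX⟩ : ∃ v ∈ U, v ∈ X := by
        by_contra! hcon
        apply hUb
        refine Metric.isBounded_closedBall.subset (fun z hz => ?_ : U ⊆ Metric.closedBall 0 R)
        by_contra hz'
        exact hcon z hz ((hXc z).2 hz')
      have hXU : X ⊆ U := by
        rw [hU, connectedComponentIn_eq hvU]
        exact (exterior_preconnected R).subset_connectedComponentIn hvX hXC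
      refine Metric.isBounded_closedBall.subset
        (fun z hz => ?_ : (closure U ∪ K)ᶜ ⊆ Metric.closedBall 0 R)
      by_contra hz'
      exact hz (Or.inl (subset_closure (hXU ((hXc z).2 hz'))))
    · rintro (h | h)
      · exact disjoint_left.1 (hUV.symm.closure_right hVo) hx0V h
      · exact hx0 (hKC h)
    · exact disjoint_left.2 fun z hz hzK => hz (Or.inr hzK)
    · rw [frontier_compl]
      intro z hz
      rcases frontier_union_subset _ _ hz with h | h
      · exact hfrK (frontier_closure_subset h.1)
      · exact hKcl.frontier_subset h.2

theorem unit_arc_joined (f : C(unitInterval, ℝ × ℝ)) {c d : unitInterval} (h : c ≤ d) :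
    JoinedIn (f '' Icc c d) (f c) (f d) := by
  have hc : Continuous (fun t : ℝ => f (projIcc 0 1 zero_le_one t)) :=
    f.continuous.comp continuous_projIcc
  have hj := arc_joined hc (show (c : ℝ) ≤ d from h)
  simp only [projIcc_val] at hj
  refine hj.mono ?_
  rintro _ ⟨t, ht, rfl⟩
  have ht' : t ∈ Icc (0 : ℝ) 1 := ⟨c.2.1.trans ht.1, ht.2.trans d.2.2⟩
  refine ⟨⟨t, ht'⟩, ⟨ht.1, ht.2⟩, ?_⟩
  simp only [projIcc_of_mem zero_le_one ht']

/-- Every clean 0-intersecting (3,3)-configuration has at least one good crossing.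
`C 0, C 1, C 2` are pairwise disjoint simple closed curves forming a nonseparating
collection; `A i` are arcs from `C 0` to `C 2`, each meeting `C 1` exactly once
(at parameter `s i`) and tangentially (both pieces of the arc lie in the same
connected component of the complement of `C 1`); cleanliness: the initial subarc
avoids `C 2` and the final subarc avoids `C 0`.  Conclusion: for some `i ≠ j`,
an initial subarc of `A i` meets an initial or final subarc of `A j`. -/
theorem stmt_6 (C : Fin 3 → Set (ℝ × ℝ))
    (hcurve : ∀ i, IsSimpleClosedCurve (C i))
    (hdisj : ∀ i j, i ≠ j → Disjoint (C i) (C j))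
    (hnonsep : ∀ i j k : Fin 3, i ≠ j → i ≠ k → j ≠ k →
      ∃ x y : ℝ × ℝ, x ∈ C j ∧ y ∈ C k ∧
        connectedComponentIn (C i)ᶜ x = connectedComponentIn (C i)ᶜ y)
    (A : Fin 3 → C(unitInterval, ℝ × ℝ))
    (s : Fin 3 → unitInterval)
    (hinit : ∀ i, A i 0 ∈ C 0)
    (hfin : ∀ i, A i 1 ∈ C 2)
    (hmid : ∀ i, A i (s i) ∈ C 1)
    (hone : ∀ i, ∀ t : unitInterval, A i t ∈ C 1 → t = s i)
    (htang : ∀ i, ∀ t u : unitInterval, t ≠ s i → u ≠ s i →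
      connectedComponentIn (C 1)ᶜ (A i t) = connectedComponentIn (C 1)ᶜ (A i u))
    (hclean₁ : ∀ i, ∀ t : unitInterval, t ≤ s i → A i t ∉ C 2)
    (hclean₂ : ∀ i, ∀ t : unitInterval, s i ≤ t → A i t ∉ C 0) :
    ∃ i j : Fin 3, i ≠ j ∧ ∃ t u : unitInterval,
      t ≤ s i ∧ (u ≤ s j ∨ s j ≤ u) ∧ A i t = A j u := by
  by_contra! hcon
  have hI : ∀ i j, i ≠ j → ∀ t u, t ≤ s i → A i t ≠ A j u := fun i j hij t u ht =>
    hcon i j hij t u ht (le_total _ _)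
  have d01 := hdisj 0 1 (by decide)
  have d21 := hdisj 2 1 (by decide)
  have d02 := hdisj 0 2 (by decide)
  have hpc : ∀ i, IsPathConnected (C i) := by
    intro i
    obtain ⟨f, -, hf⟩ := hcurve i
    rw [← hf]
    exact isPathConnected_range f.continuous
  have hs0 : ∀ i, 0 ≠ s i := fun i h => disjoint_left.1 d01 (hinit i) (h ▸ hmid i)
  have hs1 : ∀ i, 1 ≠ s i := fun i h => disjoint_left.1 d21 (hfin i) (h ▸ hmid i)
  set x0 := A 0 0 with hx0
  have hx0C : x0 ∉ C 1 := disjoint_left.1 d01 (hinit 0)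
  obtain ⟨U, hUo, hUconn, hUC, hUV, hcl⟩ := jordan_other_side (hcurve 1) x0 hx0C
  set V := connectedComponentIn (C 1)ᶜ x0 with hV
  have hC0V : C 0 ⊆ V := (hpc 0).isConnected.isPreconnected.subset_connectedComponentIn (hinit 0)
    (fun z hz => disjoint_left.1 d01 hz)
  have hAV : ∀ i t, t ≠ s i → A i t ∈ V := by
    intro i t ht
    have h1 : A i t ∈ connectedComponentIn (C 1)ᶜ (A i t) :=
      mem_connectedComponentIn fun h => ht (hone i t h)
    rw [htang i t 0 ht (hs0 i), ← connectedComponentIn_eq (hC0V (hinit i))] at h1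
    exact h1
  have hC2V : C 2 ⊆ V := by
    have hsub : C 2 ⊆ (C 1)ᶜ := fun z hz => disjoint_left.1 d21 hz
    have := (hpc 2).isConnected.isPreconnected.subset_connectedComponentIn (hfin 0) hsub
    rwa [← connectedComponentIn_eq (hAV 0 1 (hs1 0))] at this
  have hAU : ∀ i t, A i t ∉ U := by
    intro i t h
    by_cases ht : t = s i
    · exact disjoint_left.1 hUC h (ht ▸ hmid i)
    · exact disjoint_left.1 hUV h (hAV i t ht)
  have hUp : IsPathConnected U := hUo.isConnected_iff_isPathConnected.1 hUconn
  -- nearby points of `U`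
  have hnear : ∀ l : Fin 3, ∃ N : Set (ℝ × ℝ), ∃ u ∈ U, JoinedIn N u (A l (s l)) ∧
      Disjoint N (C 0) ∧ Disjoint N (C 2) ∧ ∀ j, j ≠ l → Disjoint N (range (A j)) := by
    intro l
    let Z : Set (ℝ × ℝ) := (C 0 ∪ C 2) ∪ ⋃ j ∈ {j : Fin 3 | j ≠ l}, range (A j)
    have hZ : IsClosed Z := by
      refine IsClosed.union ((curve_compact (hcurve 0)).isClosed.union
        (curve_compact (hcurve 2)).isClosed) ?_
      exact (Set.toFinite _).isClosed_biUnion fun j _ => (isCompact_range (A j).continuous).isClosed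
    have hpZ : A l (s l) ∈ Zᶜ := by
      rintro ((h | h) | h)
      · exact disjoint_left.1 d01 h (hmid l)
      · exact disjoint_left.1 d21 h (hmid l)
      · simp only [mem_iUnion] at h
        obtain ⟨j, hj, u, hu⟩ := h
        exact hI l j (Ne.symm hj) (s l) u le_rfl hu.symm
    obtain ⟨ε, hε, hb⟩ := Metric.isOpen_iff.1 hZ.isOpen_compl _ hpZ
    obtain ⟨u, hu, hdu⟩ := Metric.mem_closure_iff.1 (hcl (hmid l)) ε hε
    refine ⟨Metric.ball (A l (s l)) ε, u, hu, ?_, ?_, ?_, ?_⟩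
    · exact ((convex_ball _ _).isPathConnected ⟨_, Metric.mem_ball_self hε⟩).joinedIn _
        (by rw [Metric.mem_ball, dist_comm]; exact hdu) _ (Metric.mem_ball_self hε)
    · exact disjoint_left.2 fun z hz h => hb hz (Or.inl (Or.inl h))
    · exact disjoint_left.2 fun z hz h => hb hz (Or.inl (Or.inr h))
    · intro j hj
      exact disjoint_left.2 fun z hz h => hb hz (Or.inr (mem_biUnion (show j ∈ {j | j ≠ l} from hj) h))
  choose N u huU hNj hN0 hN2 hNA using hnear
  have hIj : ∀ j, JoinedIn (A j '' Icc 0 (s j)) (A j 0) (A j (s j)) := fun j =>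
    (unit_arc_joined (A j) (unitInterval.nonneg' : (0 : unitInterval) ≤ s j))
  have hFj : ∀ j, JoinedIn (A j '' Icc (s j) 1) (A j 1) (A j (s j)) := fun j =>
    (unit_arc_joined (A j) (unitInterval.le_one' : s j ≤ (1 : unitInterval))).symm
  refine k33 ![A 0 0, u 0, A 0 1] (fun j => A j (s j))
    (fun i j => ![C 0 ∪ A j '' Icc 0 (s j), U ∪ N j, C 2 ∪ A j '' Icc (s j) 1] i) ?_ ?_
  · intro i j
    fin_cases i
    · exact (((hpc 0).joinedIn _ (hinit 0) _ (hinit j)).mono subset_union_left).trans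
        ((hIj j).mono subset_union_right)
    · exact ((hUp.joinedIn _ (huU 0) _ (huU j)).mono subset_union_left).trans
        ((hNj j).mono subset_union_right)
    · exact (((hpc 2).joinedIn _ (hfin 0) _ (hfin j)).mono subset_union_left).trans
        ((hFj j).mono subset_union_right)
  · have k01 : ∀ j l, j ≠ l → Disjoint (C 0 ∪ A j '' Icc 0 (s j)) (U ∪ N l) := by
      intro j l hjl
      rw [disjoint_left]
      rintro z (hz | ⟨t, ht, rfl⟩) (h | h)
      · exact disjoint_left.1 hUV h (hC0V hz)
      · exact disjoint_left.1 (hN0 l) h hz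
      · exact hAU _ _ h
      · exact disjoint_left.1 (hNA l j hjl) h (mem_range_self _)
    have k12 : ∀ j l, j ≠ l → Disjoint (U ∪ N j) (C 2 ∪ A l '' Icc (s l) 1) := by
      intro j l hjl
      rw [disjoint_right]
      rintro z (hz | ⟨t, ht, rfl⟩) (h | h)
      · exact disjoint_left.1 hUV h (hC2V hz)
      · exact disjoint_left.1 (hN2 j) h hz
      · exact hAU _ _ h
      · exact disjoint_left.1 (hNA j l hjl.symm) h (mem_range_self _)
    have k02 : ∀ j l, j ≠ l →
        Disjoint (C 0 ∪ A j '' Icc 0 (s j)) (C 2 ∪ A l '' Icc (s l) 1) := by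
      intro j l hjl
      rw [disjoint_left]
      rintro z (hz | ⟨t, ht, rfl⟩) (h | ⟨v, hv, h⟩)
      · exact disjoint_left.1 d02 hz h
      · exact hclean₂ l v hv.1 (h ▸ hz)
      · exact hclean₁ j t ht.2 h
      · exact hI j l hjl t v ht.2 h.symm
    intro i j k l hik hjl
    fin_cases i <;> fin_cases k <;> first
      | (exact absurd hik (by decide))
      | exact k01 j l hjl
      | exact k12 j l hjl
      | exact k02 j l hjl
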